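/- arXiv:2104.14742 — 3 statements merged into one kernel-verified Lean document; each statement's English description precedes it below -/
import Mathlib

section
/- Let n ≥ 2. Then for every digraph D on n vertices without isolated vertices, R_{−1/2}(D) ≤ n/2, and equality holds if and only if every arc (u,v) of D satisfies d⁺(u) = d⁻(v) and every vertex w of D satisfies d⁺(w) ≥ 1 and d⁻(w) ≥ 1. -/
open Finset

/-- The out-degree of a vertex `u` in the digraph on `Fin n` with arc set `A`. -/
def outDeg {n : ℕ} (A : Finset (Fin n × Fin n)) (u : Fin n) : ℕ :=
  (A.filter (fun a => a.1 = u)).card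

/-- The in-degree of a vertex `u` in the digraph on `Fin n` with arc set `A`. -/
def inDeg {n : ℕ} (A : Finset (Fin n × Fin n)) (u : Fin n) : ℕ :=
  (A.filter (fun a => a.2 = u)).card

/-- The vertex-degree-based invariant `I(D) = (1/2) ∑_{uv ∈ A} φ(d⁺(u), d⁻(v))`. -/
noncomputable def vdbI {n : ℕ} (A : Finset (Fin n × Fin n)) (φ : ℕ → ℕ → ℝ) : ℝ :=
  (1 / 2 : ℝ) * ∑ a ∈ A, φ (outDeg A a.1) (inDeg A a.2)

/-- `D` is (isomorphic to) the out-star `K⃗_{1,n-1}`: all arcs from a center `c`. -/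
def IsStarOut {n : ℕ} (A : Finset (Fin n × Fin n)) : Prop :=
  ∃ c : Fin n, A = Finset.univ.filter (fun a => a.1 = c ∧ a.2 ≠ c)

/-- `D` is (isomorphic to) the in-star `K⃗_{n-1,1}`: all arcs into a center `c`. -/
def IsStarIn {n : ℕ} (A : Finset (Fin n × Fin n)) : Prop :=
  ∃ c : Fin n, A = Finset.univ.filter (fun a => a.2 = c ∧ a.1 ≠ c)

/-- `D` is the complete symmetric digraph `K⃡_n`: all ordered pairs of distinct vertices. -/
def IsCompleteSym {n : ℕ} (A : Finset (Fin n × Fin n)) : Prop :=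
  A = Finset.univ.filter (fun a => a.1 ≠ a.2)

/-- Summing the reciprocal fiber sizes of `f` over `s` counts the image of `f`. -/
lemma sum_inv_card_fiber {α β : Type*} [DecidableEq β] (s : Finset α) (f : α → β) :
    ∑ a ∈ s, ((#{b ∈ s | f b = f a} : ℕ) : ℝ)⁻¹ = #(s.image f) := by
  rw [Finset.sum_comp (fun c => ((#{b ∈ s | f b = c} : ℕ) : ℝ)⁻¹) f,
    Finset.card_eq_sum_ones, Nat.cast_sum]
  refine Finset.sum_congr rfl fun c hc => ?_
  obtain ⟨a, ha, rfl⟩ := Finset.mem_image.1 hc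
  have hpos : 0 < #{b ∈ s | f b = f a} :=
    Finset.card_pos.2 ⟨a, Finset.mem_filter.2 ⟨ha, rfl⟩⟩
  have hne : ((#{b ∈ s | f b = f a} : ℕ) : ℝ) ≠ 0 := by exact_mod_cast hpos.ne'
  rw [nsmul_eq_mul, mul_inv_cancel₀ hne, Nat.cast_one]

lemma sq_rpow_neg_half {x : ℝ} (hx : 0 < x) : (x ^ (-(1 / 2) : ℝ)) ^ 2 = x⁻¹ := by
  rw [← Real.rpow_natCast, ← Real.rpow_mul hx.le, ← Real.rpow_neg_one]
  norm_num

/-- The inequality of geometric and arithmetic means for the reciprocals of `x` and `y`. -/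
lemma mul_rpow_neg_half_le {x y : ℝ} (hx : 0 < x) (hy : 0 < y) :
    (x * y) ^ (-(1 / 2) : ℝ) ≤ (x⁻¹ + y⁻¹) / 2 := by
  rw [Real.mul_rpow hx.le hy.le, ← sq_rpow_neg_half hx, ← sq_rpow_neg_half hy]
  linarith [two_mul_le_add_sq (x ^ (-(1 / 2) : ℝ)) (y ^ (-(1 / 2) : ℝ))]

lemma mul_rpow_neg_half_eq_iff {x y : ℝ} (hx : 0 < x) (hy : 0 < y) :
    (x * y) ^ (-(1 / 2) : ℝ) = (x⁻¹ + y⁻¹) / 2 ↔ x = y := by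
  rw [Real.mul_rpow hx.le hy.le]
  have hx2 := sq_rpow_neg_half hx
  have hy2 := sq_rpow_neg_half hy
  constructor
  · intro h
    have hsq : (x ^ (-(1 / 2) : ℝ) - y ^ (-(1 / 2) : ℝ)) ^ 2 = 0 := by
      linear_combination hx2 + hy2 - 2 * h
    have hab := sub_eq_zero.1 (pow_eq_zero_iff two_ne_zero |>.1 hsq)
    rw [hab, hy2] at hx2
    exact (inv_injective hx2).symm
  · rintro rfl
    linear_combination hx2

lemma card_image_eq_card_iff_fiber_pos {α β : Type*} [Fintype β] [DecidableEq β]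
    (s : Finset α) (f : α → β) :
    #(s.image f) = Fintype.card β ↔ ∀ w, 1 ≤ #{a ∈ s | f a = w} := by
  rw [Finset.card_eq_iff_eq_univ, Finset.eq_univ_iff_forall]
  refine forall_congr' fun w => ?_
  rw [Nat.succ_le_iff, Finset.card_pos, Finset.mem_image]
  simp only [Finset.Nonempty, Finset.mem_filter]

theorem stmt7 (n : ℕ) (hn : 2 ≤ n)
    (A : Finset (Fin n × Fin n)) (harc : ∀ a ∈ A, a.1 ≠ a.2)
    (hni : ∀ u : Fin n, outDeg A u ≠ 0 ∨ inDeg A u ≠ 0) :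
    vdbI A (fun x y => ((x : ℝ) * (y : ℝ)) ^ (-(1 / 2) : ℝ)) ≤ (n : ℝ) / 2 ∧
      (vdbI A (fun x y => ((x : ℝ) * (y : ℝ)) ^ (-(1 / 2) : ℝ)) = (n : ℝ) / 2 ↔
        (∀ a ∈ A, outDeg A a.1 = inDeg A a.2) ∧
          ∀ w : Fin n, 1 ≤ outDeg A w ∧ 1 ≤ inDeg A w) := by
  have hpos : ∀ a ∈ A, 0 < (outDeg A a.1 : ℝ) ∧ 0 < (inDeg A a.2 : ℝ) := fun a ha =>
    ⟨Nat.cast_pos.2 (Finset.card_pos.2 ⟨a, Finset.mem_filter.2 ⟨ha, rfl⟩⟩),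
      Nat.cast_pos.2 (Finset.card_pos.2 ⟨a, Finset.mem_filter.2 ⟨ha, rfl⟩⟩)⟩
  have hle : ∀ a ∈ A, ((outDeg A a.1 : ℝ) * (inDeg A a.2 : ℝ)) ^ (-(1 / 2) : ℝ) ≤
      ((outDeg A a.1 : ℝ)⁻¹ + (inDeg A a.2 : ℝ)⁻¹) / 2 := fun a ha =>
    mul_rpow_neg_half_le (hpos a ha).1 (hpos a ha).2
  have hsum : ∑ a ∈ A, ((outDeg A a.1 : ℝ)⁻¹ + (inDeg A a.2 : ℝ)⁻¹) / 2 =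
      ((#(A.image Prod.fst) : ℝ) + #(A.image Prod.snd)) / 2 := by
    rw [← Finset.sum_div, Finset.sum_add_distrib, ← sum_inv_card_fiber A Prod.fst,
      ← sum_inv_card_fiber A Prod.snd]
    rfl
  have hS := Finset.sum_le_sum hle
  have hSeq := Finset.sum_eq_sum_iff_of_le hle
  rw [hsum] at hS hSeq
  have hp : (#(A.image Prod.fst) : ℝ) ≤ n := by
    exact_mod_cast (Finset.card_le_univ (A.image Prod.fst)).trans_eq (Fintype.card_fin n)
  have hq : (#(A.image Prod.snd) : ℝ) ≤ n := by
    exact_mod_cast (Finset.card_le_univ (A.image Prod.snd)).trans_eq (Fintype.card_fin n)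
  have harcs : (∀ a ∈ A, ((outDeg A a.1 : ℝ) * (inDeg A a.2 : ℝ)) ^ (-(1 / 2) : ℝ) =
      ((outDeg A a.1 : ℝ)⁻¹ + (inDeg A a.2 : ℝ)⁻¹) / 2) ↔
      ∀ a ∈ A, outDeg A a.1 = inDeg A a.2 :=
    forall₂_congr fun a ha =>
      (mul_rpow_neg_half_eq_iff (hpos a ha).1 (hpos a ha).2).trans Nat.cast_inj
  have hout : (#(A.image Prod.fst) : ℝ) = n ↔ ∀ w, 1 ≤ outDeg A w := by
    rw [Nat.cast_inj]
    simpa only [Fintype.card_fin, outDeg] using card_image_eq_card_iff_fiber_pos A Prod.fst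
  have hin : (#(A.image Prod.snd) : ℝ) = n ↔ ∀ w, 1 ≤ inDeg A w := by
    rw [Nat.cast_inj]
    simpa only [Fintype.card_fin, inDeg] using card_image_eq_card_iff_fiber_pos A Prod.snd
  rw [← harcs, ← hSeq, forall_and, ← hout, ← hin, vdbI]
  refine ⟨by linarith, fun h => ⟨by linarith, by linarith, by linarith⟩, ?_⟩
  rintro ⟨h, h₁, h₂⟩
  linarith
end

section
/- Let n ≥ 2 and let α be a real number with α ≤ −1. Then for every digraph D on n vertices without isolated vertices, R_α(D) ≥ (1/4)·n·(n−1)^{2α+1}, and equality holds if and only if every arc (u,v) of D satisfies d⁺(u) = d⁻(v) = n−1 and every vertex w of D satisfies exactly one of d⁺(w) = 0, d⁻(w) = 0. -/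
open Finset

theorem outDeg_le {n : ℕ} (A : Finset (Fin n × Fin n)) (harc : ∀ a ∈ A, a.1 ≠ a.2) (u : Fin n) :
    outDeg A u ≤ n - 1 := by
  have h : outDeg A u ≤ (univ.erase u).card := by
    refine Finset.card_le_card_of_injOn Prod.snd ?_ ?_
    · intro a ha
      simp only [coe_filter, Set.mem_ofPred_eq] at ha
      simpa [← ha.2] using (harc a ha.1).symm
    · intro a ha b hb hab
      simp only [coe_filter, Set.mem_ofPred_eq] at ha hb
      exact Prod.ext (ha.2.trans hb.2.symm) hab
  simpa using h

theorem inDeg_le {n : ℕ} (A : Finset (Fin n × Fin n)) (harc : ∀ a ∈ A, a.1 ≠ a.2) (u : Fin n) :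
    inDeg A u ≤ n - 1 := by
  have h : inDeg A u ≤ (univ.erase u).card := by
    refine Finset.card_le_card_of_injOn Prod.fst ?_ ?_
    · intro a ha
      simp only [coe_filter, Set.mem_ofPred_eq] at ha
      simpa [← ha.2] using harc a ha.1
    · intro a ha b hb hab
      simp only [coe_filter, Set.mem_ofPred_eq] at ha hb
      exact Prod.ext hab (ha.2.trans hb.2.symm)
  simpa using h

theorem outDeg_pos {n : ℕ} {A : Finset (Fin n × Fin n)} {a : Fin n × Fin n} (ha : a ∈ A) :
    0 < outDeg A a.1 :=
  Finset.card_pos.mpr ⟨a, by simp [ha]⟩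

theorem inDeg_pos {n : ℕ} {A : Finset (Fin n × Fin n)} {a : Fin n × Fin n} (ha : a ∈ A) :
    0 < inDeg A a.2 :=
  Finset.card_pos.mpr ⟨a, by simp [ha]⟩

/-- Summing over `A` the inverse size of the fibre of `f` counts the nonempty fibres. -/
theorem sum_inv_card_fiber_s8 {ι κ : Type*} [Fintype κ] [DecidableEq κ] (A : Finset ι) (f : ι → κ) :
    ∑ a ∈ A, (((A.filter (fun b => f b = f a)).card : ℝ))⁻¹ =
      ∑ u, if (A.filter (fun b => f b = u)).card = 0 then (0 : ℝ) else 1 := by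
  rw [← Finset.sum_fiberwise A f]
  refine Finset.sum_congr rfl fun u _ => ?_
  have h : ∀ a ∈ A.filter (fun b => f b = u), (((A.filter (fun b => f b = f a)).card : ℝ))⁻¹ =
      (((A.filter (fun b => f b = u)).card : ℝ))⁻¹ := by
    intro a ha
    rw [(Finset.mem_filter.mp ha).2]
  rw [Finset.sum_congr rfl h, Finset.sum_const, nsmul_eq_mul]
  split_ifs with h0
  · simp [h0]
  · exact mul_inv_cancel₀ (Nat.cast_ne_zero.mpr h0)

theorem rpow_mul_half_inv_add_inv_le {α N x y : ℝ} (hα : α ≤ -1) (hx : 0 < x) (hy : 0 < y)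
    (hxN : x ≤ N) (hyN : y ≤ N) :
    N ^ (2 * α + 1) / 2 * (x⁻¹ + y⁻¹) ≤ (x * y) ^ α ∧
      (N ^ (2 * α + 1) / 2 * (x⁻¹ + y⁻¹) = (x * y) ^ α ↔ x = N ∧ y = N) := by
  have hN : 0 < N := hx.trans_le hxN
  have hxy : 0 < x * y := mul_pos hx hy
  have hle : (N * N) ^ (α + 1) ≤ (x * y) ^ (α + 1) :=
    Real.rpow_le_rpow_of_nonpos hxy (mul_le_mul hxN hyN hy.le hN.le) (by linarith)
  have hP : 0 < (N * N) ^ (α + 1) := Real.rpow_pos_of_pos (by positivity) _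
  have hpowN : N ^ (2 * α + 1) = (N * N) ^ (α + 1) / N := by
    rw [Real.mul_rpow hN.le hN.le, ← Real.rpow_add hN, ← Real.rpow_sub_one hN.ne']
    ring_nf
  have hpow : (x * y) ^ α = (x * y) ^ (α + 1) / (x * y) := by
    rw [← Real.rpow_sub_one hxy.ne']
    ring_nf
  have hlhs : N ^ (2 * α + 1) / 2 * (x⁻¹ + y⁻¹) =
      (N * N) ^ (α + 1) * ((x + y) / (2 * N)) / (x * y) := by
    rw [hpowN]
    field_simp
    ring
  have hfrac : (x + y) / (2 * N) ≤ 1 := by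
    rw [div_le_one (by positivity)]
    linarith
  have hmul : (N * N) ^ (α + 1) * ((x + y) / (2 * N)) ≤ (N * N) ^ (α + 1) :=
    mul_le_of_le_one_right hP.le hfrac
  rw [hlhs, hpow]
  refine ⟨div_le_div_of_nonneg_right (hmul.trans hle) hxy.le, fun h => ?_, ?_⟩
  · rw [div_left_inj' hxy.ne'] at h
    have h1 : (N * N) ^ (α + 1) * ((x + y) / (2 * N)) = (N * N) ^ (α + 1) * 1 := by linarith
    have h2 := mul_left_cancel₀ hP.ne' h1
    rw [div_eq_one_iff_eq (by positivity)] at h2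
    constructor <;> linarith
  · rintro ⟨rfl, rfl⟩
    congr 1
    field_simp
    norm_num

theorem stmt8 (n : ℕ) (hn : 2 ≤ n) (α : ℝ) (hα : α ≤ -1)
    (A : Finset (Fin n × Fin n)) (harc : ∀ a ∈ A, a.1 ≠ a.2)
    (hni : ∀ u : Fin n, outDeg A u ≠ 0 ∨ inDeg A u ≠ 0) :
    (1 / 4 : ℝ) * n * ((n : ℝ) - 1) ^ (2 * α + 1) ≤ vdbI A (fun x y => ((x : ℝ) * (y : ℝ)) ^ α) ∧
      (vdbI A (fun x y => ((x : ℝ) * (y : ℝ)) ^ α) = (1 / 4 : ℝ) * n * ((n : ℝ) - 1) ^ (2 * α + 1) ↔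
        (∀ a ∈ A, outDeg A a.1 = n - 1 ∧ inDeg A a.2 = n - 1) ∧
          ∀ w : Fin n, Xor' (outDeg A w = 0) (inDeg A w = 0)) := by
  set N : ℝ := (n : ℝ) - 1 with hNdef
  have hcast : ((n - 1 : ℕ) : ℝ) = N := by
    rw [Nat.cast_sub (by omega), Nat.cast_one]
  have hN : 0 < N := by
    rw [← hcast]
    exact_mod_cast (by omega : 0 < n - 1)
  have hC : 0 < N ^ (2 * α + 1) := Real.rpow_pos_of_pos hN _
  have key : ∀ a ∈ A, _ := fun a ha =>
    rpow_mul_half_inv_add_inv_le (N := N) hα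
      (Nat.cast_pos.mpr (outDeg_pos ha)) (Nat.cast_pos.mpr (inDeg_pos ha))
      (hcast ▸ Nat.cast_le.mpr (outDeg_le A harc a.1))
      (hcast ▸ Nat.cast_le.mpr (inDeg_le A harc a.2))
  have hsum := Finset.sum_le_sum fun a ha => (key a ha).1
  have hsum_eq := Finset.sum_eq_sum_iff_of_le fun a ha => (key a ha).1
  rw [← Finset.mul_sum, Finset.sum_add_distrib] at hsum hsum_eq
  have hout : ∑ a ∈ A, ((outDeg A a.1 : ℝ))⁻¹ = ∑ u, if outDeg A u = 0 then (0 : ℝ) else 1 :=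
    sum_inv_card_fiber_s8 A Prod.fst
  have hin : ∑ a ∈ A, ((inDeg A a.2 : ℝ))⁻¹ = ∑ u, if inDeg A u = 0 then (0 : ℝ) else 1 :=
    sum_inv_card_fiber_s8 A Prod.snd
  rw [hout, hin, ← Finset.sum_add_distrib] at hsum hsum_eq
  have hvert : ∀ u ∈ (univ : Finset (Fin n)), (1 : ℝ) ≤
      (if outDeg A u = 0 then (0 : ℝ) else 1) + (if inDeg A u = 0 then (0 : ℝ) else 1) := by
    intro u _
    have := hni u
    split_ifs <;> simp_all
  have hcount := Finset.sum_le_sum hvert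
  have hcount_eq := Finset.sum_eq_sum_iff_of_le hvert
  simp only [Finset.sum_const, Finset.card_univ, Fintype.card_fin, nsmul_eq_mul, mul_one]
    at hcount hcount_eq
  have hxor : (∀ w : Fin n, Xor' (outDeg A w = 0) (inDeg A w = 0)) ↔
      ∀ u ∈ (univ : Finset (Fin n)), (1 : ℝ) =
        (if outDeg A u = 0 then (0 : ℝ) else 1) + (if inDeg A u = 0 then (0 : ℝ) else 1) := by
    refine forall_congr' fun u => ?_
    have := hni u
    by_cases h1 : outDeg A u = 0 <;> by_cases h2 : inDeg A u = 0 <;> simp_all [Xor']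
  have harcs : (∀ a ∈ A, outDeg A a.1 = n - 1 ∧ inDeg A a.2 = n - 1) ↔
      ∀ a ∈ A, N ^ (2 * α + 1) / 2 * ((outDeg A a.1 : ℝ)⁻¹ + (inDeg A a.2 : ℝ)⁻¹) =
        ((outDeg A a.1 : ℝ) * (inDeg A a.2 : ℝ)) ^ α := by
    refine forall₂_congr fun a ha => ?_
    rw [(key a ha).2, ← hcast, Nat.cast_inj, Nat.cast_inj]
  rw [hxor, harcs, ← hcount_eq, ← hsum_eq]
  unfold vdbI
  set S := ∑ a ∈ A, ((outDeg A a.1 : ℝ) * (inDeg A a.2 : ℝ)) ^ α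
  set T := ∑ u, ((if outDeg A u = 0 then (0 : ℝ) else 1) + (if inDeg A u = 0 then (0 : ℝ) else 1))
  have hmul := mul_le_mul_of_nonneg_left hcount hC.le
  refine ⟨by linarith, fun h => ?_, fun ⟨h1, h2⟩ => ?_⟩
  · exact ⟨by linarith, mul_left_cancel₀ hC.ne' (by linarith)⟩
  · rw [← h1, ← h2]
    ring
end

section
/- Let α be a real number with −1/2 ≤ α < 0. Then there exists N such that for every n ≥ N and every digraph D on n vertices without isolated vertices, R_α(D) ≥ (1/2)·(n−1)^{α+1}, and equality holds if and only if D is isomorphic to K⃗_{1,n−1} or to K⃗_{n−1,1}. -/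
open Finset

/-- Concavity of `t ↦ t ^ b` gives `M ^ b * (t + 1) ≤ t ^ b * (M + 1)` on `[1, M]`, strictly
for `t < M`. -/
lemma rpow_mul_add_one_lt {b M t : ℝ} (hb₀ : 0 ≤ b) (hb₁ : b ≤ 1) (ht : 1 ≤ t) (htM : t < M)
    (hM : 2 * M ^ b < M + 1) : M ^ b * (t + 1) < t ^ b * (M + 1) := by
  have hM1 : 0 < M - 1 := by linarith
  have hconc := (Real.concaveOn_rpow hb₀ hb₁).2
    (Set.mem_Ici.2 zero_le_one) (Set.mem_Ici.2 (by linarith : 0 ≤ M))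
    (div_nonneg (by linarith : 0 ≤ M - t) hM1.le) (div_nonneg (by linarith : 0 ≤ t - 1) hM1.le)
    (by field_simp; ring)
  have hcomb : (M - t) / (M - 1) * 1 + (t - 1) / (M - 1) * M = t := by field_simp; ring
  simp only [smul_eq_mul, Real.one_rpow, hcomb] at hconc
  have hpos : 0 < (M - t) / (M - 1) := div_pos (by linarith) hM1
  have hdiff : ((M - t) / (M - 1) * 1 + (t - 1) / (M - 1) * M ^ b) * (M + 1) - M ^ b * (t + 1)
      = (M - t) / (M - 1) * (M + 1 - 2 * M ^ b) := by
    field_simp; ring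
  nlinarith [mul_le_mul_of_nonneg_right hconc (by linarith : 0 ≤ M + 1),
    mul_pos hpos (by linarith : 0 < M + 1 - 2 * M ^ b)]

lemma rpow_mul_add_one_le {b M t : ℝ} (hb₀ : 0 ≤ b) (hb₁ : b ≤ 1) (ht : 1 ≤ t) (htM : t ≤ M)
    (hM : 2 * M ^ b < M + 1) : M ^ b * (t + 1) ≤ t ^ b * (M + 1) := by
  rcases htM.lt_or_eq with h | rfl
  · exact (rpow_mul_add_one_lt hb₀ hb₁ ht h hM).le
  · exact le_rfl

lemma rpow_mul_add_le {b M x y : ℝ} (hb₀ : 0 ≤ b) (hb₁ : b ≤ 1) (hx : 1 ≤ x)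
    (hy : 1 ≤ y) (hxy : x + y ≤ M + 1) (hM : 2 * M ^ b < M + 1) :
    M ^ b * (x + y) ≤ (x * y) ^ b * (M + 1) := by
  have hkey := rpow_mul_add_one_le hb₀ hb₁ (by linarith : 1 ≤ x + y - 1) (by linarith) hM
  have hmono : (x + y - 1) ^ b ≤ (x * y) ^ b :=
    Real.rpow_le_rpow (by linarith) (by nlinarith) hb₀
  have := mul_le_mul_of_nonneg_right hmono (by linarith : 0 ≤ M + 1)
  rw [sub_add_cancel] at hkey
  exact hkey.trans this

lemma eq_of_rpow_mul_add_eq {b M x y : ℝ} (hb₀ : 0 < b) (hb₁ : b ≤ 1) (hx : 1 ≤ x)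
    (hy : 1 ≤ y) (hxy : x + y ≤ M + 1) (hM : 2 * M ^ b < M + 1)
    (heq : M ^ b * (x + y) = (x * y) ^ b * (M + 1)) :
    x + y = M + 1 ∧ (x = 1 ∨ y = 1) := by
  have hmono : (x + y - 1) ^ b ≤ (x * y) ^ b :=
    Real.rpow_le_rpow (by linarith) (by nlinarith) hb₀.le
  have hpos : 0 < M + 1 := by linarith
  constructor
  · by_contra hne
    have hlt := rpow_mul_add_one_lt hb₀.le hb₁ (by linarith : 1 ≤ x + y - 1)
      (by linarith [lt_of_le_of_ne hxy hne]) hM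
    rw [sub_add_cancel] at hlt
    linarith [mul_le_mul_of_nonneg_right hmono hpos.le]
  · by_contra! hne
    have hx' : 1 < x := lt_of_le_of_ne hx (Ne.symm hne.1)
    have hy' : 1 < y := lt_of_le_of_ne hy (Ne.symm hne.2)
    have hle := rpow_mul_add_one_le hb₀.le hb₁ (by linarith : 1 ≤ x + y - 1) (by linarith) hM
    rw [sub_add_cancel] at hle
    have hlt : (x + y - 1) ^ b < (x * y) ^ b :=
      Real.rpow_lt_rpow (by linarith) (by nlinarith [mul_pos (sub_pos.2 hx') (sub_pos.2 hy')]) hb₀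
    linarith [mul_lt_mul_of_pos_right hlt hpos]

lemma rpow_sub_one_sub_eq {b M x y : ℝ} (hx : 0 < x) (hy : 0 < y) (hM : 0 < M + 1) :
    (x * y) ^ (b - 1) - M ^ b / (M + 1) * (1 / x + 1 / y)
      = ((x * y) ^ b * (M + 1) - M ^ b * (x + y)) / ((x * y) * (M + 1)) := by
  rw [Real.rpow_sub_one (mul_pos hx hy).ne']
  field_simp
  ring

section Degrees

variable {n : ℕ} (A : Finset (Fin n × Fin n))

lemma sum_one_div_card_fiber {ι κ : Type*} [DecidableEq κ] (s : Finset ι) (f : ι → κ) :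
    ∑ a ∈ s, (1 : ℝ) / (#{b ∈ s | f b = f a} : ℝ) = #(s.image f) := by
  rw [← Finset.sum_fiberwise_of_maps_to (g := f) (fun a ha => Finset.mem_image_of_mem f ha),
    Finset.card_eq_sum_ones, Nat.cast_sum]
  refine Finset.sum_congr rfl fun k hk => ?_
  obtain ⟨a, ha, rfl⟩ := Finset.mem_image.1 hk
  have hne : (#{b ∈ s | f b = f a} : ℝ) ≠ 0 :=
    Nat.cast_ne_zero.2 (Finset.card_ne_zero_of_mem (Finset.mem_filter.2 ⟨ha, rfl⟩))
  rw [Finset.sum_congr rfl (g := fun _ => (1 : ℝ) / (#{b ∈ s | f b = f a} : ℝ))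
    (fun c hc => by rw [(Finset.mem_filter.1 hc).2]), Finset.sum_const, nsmul_eq_mul]
  field_simp
  simp

lemma sum_one_div_outDeg : ∑ a ∈ A, (1 : ℝ) / outDeg A a.1 = #(A.image Prod.fst) :=
  sum_one_div_card_fiber A Prod.fst

lemma sum_one_div_inDeg : ∑ a ∈ A, (1 : ℝ) / inDeg A a.2 = #(A.image Prod.snd) :=
  sum_one_div_card_fiber A Prod.snd

lemma outDeg_le_card_image_snd (u : Fin n) : outDeg A u ≤ #(A.image Prod.snd) := by
  refine Finset.card_le_card_of_injOn Prod.snd (fun a ha => ?_) fun a ha b hb hab => ?_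
  · exact Finset.mem_coe.2 (Finset.mem_image_of_mem _ (Finset.mem_filter.1 ha).1)
  · exact Prod.ext ((Finset.mem_filter.1 ha).2.trans (Finset.mem_filter.1 hb).2.symm) hab

lemma inDeg_le_card_image_fst (u : Fin n) : inDeg A u ≤ #(A.image Prod.fst) := by
  refine Finset.card_le_card_of_injOn Prod.fst (fun a ha => ?_) fun a ha b hb hab => ?_
  · exact Finset.mem_coe.2 (Finset.mem_image_of_mem _ (Finset.mem_filter.1 ha).1)
  · exact Prod.ext hab ((Finset.mem_filter.1 ha).2.trans (Finset.mem_filter.1 hb).2.symm)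

variable {A}

lemma one_le_outDeg {a : Fin n × Fin n} (ha : a ∈ A) : 1 ≤ outDeg A a.1 :=
  Finset.card_pos.2 ⟨a, Finset.mem_filter.2 ⟨ha, rfl⟩⟩

lemma one_le_inDeg {a : Fin n × Fin n} (ha : a ∈ A) : 1 ≤ inDeg A a.2 :=
  Finset.card_pos.2 ⟨a, Finset.mem_filter.2 ⟨ha, rfl⟩⟩

lemma le_card_image_fst_add_card_image_snd (h : ∀ u : Fin n, outDeg A u ≠ 0 ∨ inDeg A u ≠ 0) :
    n ≤ #(A.image Prod.fst) + #(A.image Prod.snd) := by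
  have hcover : (Finset.univ : Finset (Fin n)) ⊆ A.image Prod.fst ∪ A.image Prod.snd := by
    intro u _
    rcases h u with hu | hu <;> obtain ⟨a, ha⟩ := Finset.card_ne_zero.1 hu <;>
      obtain ⟨haA, rfl⟩ := Finset.mem_filter.1 ha
    · exact Finset.mem_union_left _ (Finset.mem_image_of_mem _ haA)
    · exact Finset.mem_union_right _ (Finset.mem_image_of_mem _ haA)
  simpa using (Finset.card_le_card hcover).trans (Finset.card_union_le _ _)

lemma card_outStar (c : Fin n) :
    #{a : Fin n × Fin n | a.1 = c ∧ a.2 ≠ c} = n - 1 := by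
  have : ({a : Fin n × Fin n | a.1 = c ∧ a.2 ≠ c} : Finset _) = {c} ×ˢ Finset.univ.erase c := by
    ext; simp only [Finset.mem_filter_univ, Finset.mem_product, Finset.mem_singleton,
      Finset.mem_erase, Finset.mem_univ, and_true]
  simp [this]

lemma card_inStar (c : Fin n) :
    #{a : Fin n × Fin n | a.2 = c ∧ a.1 ≠ c} = n - 1 := by
  have : ({a : Fin n × Fin n | a.2 = c ∧ a.1 ≠ c} : Finset _) = Finset.univ.erase c ×ˢ {c} := by
    ext; simp only [Finset.mem_filter_univ, Finset.mem_product, Finset.mem_singleton,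
      Finset.mem_erase, Finset.mem_univ, true_and, and_comm]
  simp [this]

lemma isStarOut_of_outDeg (hA : ∀ a ∈ A, a.1 ≠ a.2) {u : Fin n} (hu : outDeg A u = n - 1)
    (hp : #(A.image Prod.fst) ≤ 1) (hmem : u ∈ A.image Prod.fst) : IsStarOut A := by
  have hfst : ∀ a ∈ A, a.1 = u := fun a ha =>
    Finset.card_le_one.1 hp _ (Finset.mem_image_of_mem _ ha) _ hmem
  refine ⟨u, Finset.eq_of_subset_of_card_le (fun a ha => ?_) ?_⟩
  · exact Finset.mem_filter.2 ⟨Finset.mem_univ _, hfst a ha, fun h => hA a ha (by rw [h, hfst a ha])⟩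
  · rw [card_outStar, ← hu]
    exact Finset.card_filter_le _ _

lemma isStarIn_of_inDeg (hA : ∀ a ∈ A, a.1 ≠ a.2) {u : Fin n} (hu : inDeg A u = n - 1)
    (hq : #(A.image Prod.snd) ≤ 1) (hmem : u ∈ A.image Prod.snd) : IsStarIn A := by
  have hsnd : ∀ a ∈ A, a.2 = u := fun a ha =>
    Finset.card_le_one.1 hq _ (Finset.mem_image_of_mem _ ha) _ hmem
  refine ⟨u, Finset.eq_of_subset_of_card_le (fun a ha => ?_) ?_⟩
  · exact Finset.mem_filter.2 ⟨Finset.mem_univ _, hsnd a ha, fun h => hA a ha (by rw [h, hsnd a ha])⟩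
  · rw [card_inStar, ← hu]
    exact Finset.card_filter_le _ _

lemma vdbI_eq_of_forall_mul_eq (hn : 2 ≤ n) (α : ℝ) (hcard : #A = n - 1)
    (h : ∀ a ∈ A, outDeg A a.1 * inDeg A a.2 = n - 1) :
    vdbI A (fun x y => ((x : ℝ) * (y : ℝ)) ^ α) = (1 / 2 : ℝ) * ((n : ℝ) - 1) ^ (α + 1) := by
  have hcast : ((n - 1 : ℕ) : ℝ) = (n : ℝ) - 1 := by push_cast [Nat.cast_sub (by lia : 1 ≤ n)]; ring
  have hpos : (n : ℝ) - 1 ≠ 0 := by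
    rw [← hcast]; exact Nat.cast_ne_zero.2 (by lia)
  rw [vdbI, Finset.sum_congr rfl (g := fun _ => ((n : ℝ) - 1) ^ α), Finset.sum_const, hcard,
    nsmul_eq_mul, hcast, Real.rpow_add_one hpos, mul_comm (((n : ℝ) - 1) ^ α)]
  intro a ha
  rw [← Nat.cast_mul, h a ha, hcast]

lemma IsStarOut.vdbI_eq (hn : 2 ≤ n) (α : ℝ) (h : IsStarOut A) :
    vdbI A (fun x y => ((x : ℝ) * (y : ℝ)) ^ α) = (1 / 2 : ℝ) * ((n : ℝ) - 1) ^ (α + 1) := by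
  obtain ⟨c, hc⟩ := h
  have hcard : #A = n - 1 := by rw [hc, card_outStar]
  have hmem : ∀ a ∈ A, a.1 = c := fun a ha => by rw [hc] at ha; exact (Finset.mem_filter.1 ha).2.1
  refine vdbI_eq_of_forall_mul_eq hn α hcard fun a ha => ?_
  have hout : outDeg A a.1 = n - 1 := by
    rw [outDeg, Finset.filter_true_of_mem fun b hb => (hmem b hb).trans (hmem a ha).symm, hcard]
  have hin : inDeg A a.2 = 1 := le_antisymm (Finset.card_le_one.2 fun b hb d hd => by
    rw [Finset.mem_filter] at hb hd
    exact Prod.ext ((hmem b hb.1).trans (hmem d hd.1).symm) (hb.2.trans hd.2.symm))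
    (one_le_inDeg ha)
  rw [hout, hin, mul_one]

lemma IsStarIn.vdbI_eq (hn : 2 ≤ n) (α : ℝ) (h : IsStarIn A) :
    vdbI A (fun x y => ((x : ℝ) * (y : ℝ)) ^ α) = (1 / 2 : ℝ) * ((n : ℝ) - 1) ^ (α + 1) := by
  obtain ⟨c, hc⟩ := h
  have hcard : #A = n - 1 := by rw [hc, card_inStar]
  have hmem : ∀ a ∈ A, a.2 = c := fun a ha => by rw [hc] at ha; exact (Finset.mem_filter.1 ha).2.1
  refine vdbI_eq_of_forall_mul_eq hn α hcard fun a ha => ?_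
  have hin : inDeg A a.2 = n - 1 := by
    rw [inDeg, Finset.filter_true_of_mem fun b hb => (hmem b hb).trans (hmem a ha).symm, hcard]
  have hout : outDeg A a.1 = 1 := le_antisymm (Finset.card_le_one.2 fun b hb d hd => by
    rw [Finset.mem_filter] at hb hd
    exact Prod.ext (hb.2.trans hd.2.symm) ((hmem b hb.1).trans (hmem d hd.1).symm))
    (one_le_outDeg ha)
  rw [hout, hin, one_mul]

end Degrees

lemma exists_forall_two_mul_rpow_lt {b : ℝ} (hb : b < 1) :
    ∃ N : ℝ, ∀ M : ℝ, N ≤ M → 2 * M ^ b < M + 1 := by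
  have hev := ((tendsto_rpow_atTop (sub_pos.2 hb)).eventually_ge_atTop 2).and
    (Filter.eventually_gt_atTop 0)
  obtain ⟨N, hN⟩ := Filter.eventually_atTop.1 hev
  refine ⟨N, fun M hM => ?_⟩
  obtain ⟨h2, hpos⟩ := hN M hM
  have hsplit : M ^ (1 - b) * M ^ b = M := by
    rw [← Real.rpow_add hpos, sub_add_cancel, Real.rpow_one]
  linarith [mul_le_mul_of_nonneg_right h2 (Real.rpow_nonneg hpos.le b)]

theorem stmt10 (α : ℝ) (hα₁ : -(1 / 2) ≤ α) (hα₂ : α < 0) :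
    ∃ N : ℕ, ∀ n : ℕ, N ≤ n →
      ∀ A : Finset (Fin n × Fin n), (∀ a ∈ A, a.1 ≠ a.2) →
        (∀ u : Fin n, outDeg A u ≠ 0 ∨ inDeg A u ≠ 0) →
          (1 / 2 : ℝ) * ((n : ℝ) - 1) ^ (α + 1) ≤ vdbI A (fun x y => ((x : ℝ) * (y : ℝ)) ^ α) ∧
            (vdbI A (fun x y => ((x : ℝ) * (y : ℝ)) ^ α) = (1 / 2 : ℝ) * ((n : ℝ) - 1) ^ (α + 1) ↔ IsStarOut A ∨ IsStarIn A) := by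
  obtain ⟨N, hN⟩ := exists_forall_two_mul_rpow_lt (b := α + 1) (by linarith)
  refine ⟨max 2 (⌈N⌉₊ + 1), fun n hn A hA hiso => ?_⟩
  have hn2 : 2 ≤ n := (le_max_left _ _).trans hn
  have hnN : N + 1 ≤ n := by
    have : ((⌈N⌉₊ + 1 : ℕ) : ℝ) ≤ n := Nat.cast_le.2 ((le_max_right _ _).trans hn)
    push_cast at this
    linarith [Nat.le_ceil N]
  have hb₀ : 0 < α + 1 := by linarith
  have hb₁ : α + 1 ≤ 1 := by linarith
  set p := #(A.image Prod.fst) with hp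
  set q := #(A.image Prod.snd) with hq
  have hnpq : n ≤ p + q := le_card_image_fst_add_card_image_snd hiso
  have hn2' : (2 : ℝ) ≤ n := by exact_mod_cast hn2
  have hnpq' : (n : ℝ) ≤ p + q := by exact_mod_cast hnpq
  obtain ⟨M, hMdef⟩ : ∃ M : ℝ, M = p + q - 1 := ⟨_, rfl⟩
  have hMpos : 0 < M + 1 := by linarith
  have hM := hN M (by linarith)
  have hx : ∀ a ∈ A, (1 : ℝ) ≤ outDeg A a.1 := fun a ha => by exact_mod_cast one_le_outDeg ha
  have hy : ∀ a ∈ A, (1 : ℝ) ≤ inDeg A a.2 := fun a ha => by exact_mod_cast one_le_inDeg ha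
  have hxy : ∀ a ∈ A, (outDeg A a.1 : ℝ) + inDeg A a.2 ≤ M + 1 := fun a _ => by
    have h₁ : (outDeg A a.1 : ℝ) ≤ q := by exact_mod_cast outDeg_le_card_image_snd A a.1
    have h₂ : (inDeg A a.2 : ℝ) ≤ p := by exact_mod_cast inDeg_le_card_image_fst A a.2
    linarith
  have hgap : ∀ a ∈ A, ((outDeg A a.1 : ℝ) * inDeg A a.2) ^ α
      - M ^ (α + 1) / (M + 1) * (1 / outDeg A a.1 + 1 / inDeg A a.2)
      = (((outDeg A a.1 : ℝ) * inDeg A a.2) ^ (α + 1) * (M + 1)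
          - M ^ (α + 1) * (outDeg A a.1 + inDeg A a.2))
        / (((outDeg A a.1 : ℝ) * inDeg A a.2) * (M + 1)) := fun a ha => by
    simpa using rpow_sub_one_sub_eq (b := α + 1) (lt_of_lt_of_le one_pos (hx a ha))
      (lt_of_lt_of_le one_pos (hy a ha)) hMpos
  have hden : ∀ a ∈ A, 0 < ((outDeg A a.1 : ℝ) * inDeg A a.2) * (M + 1) := fun a ha =>
    mul_pos (mul_pos (by linarith [hx a ha]) (by linarith [hy a ha])) hMpos
  have hterm : ∀ a ∈ A, M ^ (α + 1) / (M + 1) * (1 / outDeg A a.1 + 1 / inDeg A a.2)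
      ≤ ((outDeg A a.1 : ℝ) * inDeg A a.2) ^ α := fun a ha => by
    rw [← sub_nonneg, hgap a ha]
    exact div_nonneg (sub_nonneg.2
      (rpow_mul_add_le hb₀.le hb₁ (hx a ha) (hy a ha) (hxy a ha) hM)) (hden a ha).le
  have hsum : ∑ a ∈ A, M ^ (α + 1) / (M + 1) * ((1 : ℝ) / outDeg A a.1 + 1 / inDeg A a.2)
      = M ^ (α + 1) := by
    rw [← Finset.mul_sum, Finset.sum_add_distrib, sum_one_div_outDeg, sum_one_div_inDeg, ← hp,
      ← hq, show (p : ℝ) + q = M + 1 by linarith, div_mul_cancel₀ _ hMpos.ne']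
  have hle : M ^ (α + 1) ≤ ∑ a ∈ A, ((outDeg A a.1 : ℝ) * inDeg A a.2) ^ α :=
    hsum.symm.trans_le (Finset.sum_le_sum hterm)
  have hmono : ((n : ℝ) - 1) ^ (α + 1) ≤ M ^ (α + 1) :=
    Real.rpow_le_rpow (by linarith) (by linarith) hb₀.le
  refine ⟨mul_le_mul_of_nonneg_left (hmono.trans hle) (by norm_num), fun heq => ?_, ?_⟩
  · have heq' : ∑ a ∈ A, ((outDeg A a.1 : ℝ) * inDeg A a.2) ^ α = ((n : ℝ) - 1) ^ (α + 1) :=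
      mul_left_cancel₀ (by norm_num) heq
    have hMn : M = n - 1 := by
      refine (Real.rpow_left_inj (by linarith) (by linarith) hb₀.ne').1 ?_
      linarith
    have hpqn : p + q = n := by
      have : (p : ℝ) + q = n := by linarith
      exact_mod_cast this
    have hall := (Finset.sum_eq_sum_iff_of_le hterm).1 (by rw [hsum, heq', hMn])
    obtain ⟨a, ha⟩ : A.Nonempty := by
      rw [Finset.nonempty_iff_ne_empty]
      rintro rfl
      simp [p, q] at hpqn
      lia
    have hnum := hgap a ha
    rw [← hall a ha, sub_self, eq_comm, div_eq_zero_iff, or_iff_left (hden a ha).ne',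
      sub_eq_zero] at hnum
    obtain ⟨hadd, hone⟩ := eq_of_rpow_mul_add_eq hb₀ hb₁ (hx a ha) (hy a ha) (hxy a ha) hM hnum.symm
    have hadd' : outDeg A a.1 + inDeg A a.2 = n := by
      have : (outDeg A a.1 : ℝ) + inDeg A a.2 = n := by linarith
      exact_mod_cast this
    have hout := outDeg_le_card_image_snd A a.1
    have hin := inDeg_le_card_image_fst A a.2
    rcases hone with h | h
    · have h1 : outDeg A a.1 = 1 := by exact_mod_cast h
      exact Or.inr (isStarIn_of_inDeg hA (u := a.2) (by lia) (by lia)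
        (Finset.mem_image_of_mem _ ha))
    · have h1 : inDeg A a.2 = 1 := by exact_mod_cast h
      exact Or.inl (isStarOut_of_outDeg hA (u := a.1) (by lia) (by lia)
        (Finset.mem_image_of_mem _ ha))
  · rintro (h | h)
    · exact h.vdbI_eq hn2 α
    · exact h.vdbI_eq hn2 α
end
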